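/- arXiv:0901.0772 — 9 statements merged into one kernel-verified Lean document; each statement's English description precedes it below -/
import Mathlib

section
/- Let (A; z₁,z₂,z₃,z₄) be a θ-deformed 7-sphere datum. Then the 4×2 matrix Ψ over A whose first column is (z₁,z₂,z₃,z₄)ᵗ and whose second column is (−z₂*, z₁*, −z₄*, z₃*)ᵗ satisfies Ψ^★Ψ = I₂ (the 2×2 identity matrix over A), and consequently q := ΨΨ^★ ∈ M₄(A) satisfies q* = q, q² = q, and trace(q) = 2·1_A. -/
open Matrix

/-- The deformation parameter μ = exp(πiθ). -/
noncomputable def muDef (θ : ℝ) : ℂ := Complex.exp (Real.pi * Complex.I * θ)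

/-- The 4×4 matrix of deformation parameters η. -/
noncomputable def etaDef (θ : ℝ) : Fin 4 → Fin 4 → ℂ :=
  ![![1, 1, starRingEnd ℂ (muDef θ), muDef θ],
    ![1, 1, muDef θ, starRingEnd ℂ (muDef θ)],
    ![muDef θ, starRingEnd ℂ (muDef θ), 1, 1],
    ![starRingEnd ℂ (muDef θ), muDef θ, 1, 1]]

/-- For a θ-deformed 7-sphere datum `(A; z₁,…,z₄)`, the 4×2 matrix Ψ with
columns `(z₁,z₂,z₃,z₄)ᵗ` and `(−z₂*, z₁*, −z₄*, z₃*)ᵗ` satisfies `Ψᴴ Ψ = 1`, and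
`q = Ψ Ψᴴ` is a self-adjoint idempotent of trace `2`. -/
theorem stmt0 (θ : ℝ) (A : Type*) [Ring A] [Algebra ℂ A] [StarRing A] [StarModule ℂ A]
    (z : Fin 4 → A)
    (hzz : ∀ j l, z j * z l = etaDef θ j l • (z l * z j))
    (hzs : ∀ j l, z j * star (z l) = etaDef θ l j • (star (z l) * z j))
    (hsph : star (z 0) * z 0 + star (z 1) * z 1 + star (z 2) * z 2 + star (z 3) * z 3 = 1)
    (Ψ : Matrix (Fin 4) (Fin 2) A)
    (hΨ : Ψ = !![z 0, -star (z 1);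
                 z 1,  star (z 0);
                 z 2, -star (z 3);
                 z 3,  star (z 2)]) :
    Ψᴴ * Ψ = 1 ∧
    (Ψ * Ψᴴ)ᴴ = Ψ * Ψᴴ ∧
    (Ψ * Ψᴴ) * (Ψ * Ψᴴ) = Ψ * Ψᴴ ∧
    (Ψ * Ψᴴ).trace = 2 := by
  have hnormal : ∀ j, z j * star (z j) = star (z j) * z j := fun j => by
    have h := hzs j j
    fin_cases j <;> simpa [etaDef] using h
  have h01 : z 0 * z 1 = z 1 * z 0 := by simpa [etaDef] using hzz 0 1
  have h23 : z 2 * z 3 = z 3 * z 2 := by simpa [etaDef] using hzz 2 3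
  have h01' : star (z 0) * star (z 1) = star (z 1) * star (z 0) := by
    rw [← star_mul, ← star_mul, h01]
  have h23' : star (z 2) * star (z 3) = star (z 3) * star (z 2) := by
    rw [← star_mul, ← star_mul, h23]
  have hone : Ψᴴ * Ψ = 1 := by
    subst hΨ
    ext i j
    fin_cases i <;> fin_cases j <;>
      simp [Matrix.mul_apply, Fin.sum_univ_four, hnormal, h01, h23, h01', h23', ← hsph]
    abel
  refine ⟨hone, ?_, ?_, ?_⟩
  · rw [conjTranspose_mul, conjTranspose_conjTranspose]
  · rw [Matrix.mul_assoc, ← Matrix.mul_assoc Ψᴴ, hone, Matrix.one_mul]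
  · subst hΨ
    simp only [Matrix.trace, Matrix.diag, Matrix.mul_apply, Fin.sum_univ_four, Fin.sum_univ_two]
    simp [hnormal]
    rw [← one_add_one_eq_two, ← hsph]
    abel
end

section
/- Let (A; z₁,z₂,z₃,z₄) be a θ-deformed 7-sphere datum, Ψ the 4×2 matrix with columns (z₁,z₂,z₃,z₄)ᵗ and (−z₂*, z₁*, −z₄*, z₃*)ᵗ, and set α := 2(z₁z₃* + z₂*z₄), β := 2(z₂z₃* − z₁*z₄), x := z₁z₁* + z₂z₂* − z₃z₃* − z₄z₄*. Then ΨΨ^★ equals (1/2) times the 4×4 matrix [[1+x, 0, α, −μ̄β*], [0, 1+x, β, μα*], [α*, β*, 1−x, 0], [−μβ, μ̄α, 0, 1−x]]. -/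
open Matrix

theorem conj_muDef_mul_muDef (θ : ℝ) : starRingEnd ℂ (muDef θ) * muDef θ = 1 := by
  rw [muDef, ← Complex.exp_conj, ← Complex.exp_add]
  simp

set_option maxHeartbeats 400000 in
/-- For a θ-deformed 7-sphere datum, with α = 2(z₁z₃* + z₂*z₄),
β = 2(z₂z₃* − z₁*z₄), x = z₁z₁* + z₂z₂* − z₃z₃* − z₄z₄*, the projection ΨΨᴴ equals
(1/2)·[[1+x, 0, α, −μ̄β*], [0, 1+x, β, μα*], [α*, β*, 1−x, 0], [−μβ, μ̄α, 0, 1−x]]. -/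
theorem stmt1 (θ : ℝ) (A : Type*) [Ring A] [Algebra ℂ A] [StarRing A] [StarModule ℂ A]
    (z : Fin 4 → A)
    (hzz : ∀ j l, z j * z l = etaDef θ j l • (z l * z j))
    (hzs : ∀ j l, z j * star (z l) = etaDef θ l j • (star (z l) * z j))
    (hsph : star (z 0) * z 0 + star (z 1) * z 1 + star (z 2) * z 2 + star (z 3) * z 3 = 1)
    (Ψ : Matrix (Fin 4) (Fin 2) A)
    (hΨ : Ψ = !![z 0, -star (z 1);
                 z 1,  star (z 0);
                 z 2, -star (z 3);
                 z 3,  star (z 2)])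
    (α β x : A)
    (hα : α = 2 * (z 0 * star (z 2) + star (z 1) * z 3))
    (hβ : β = 2 * (z 1 * star (z 2) - star (z 0) * z 3))
    (hx : x = z 0 * star (z 0) + z 1 * star (z 1) - z 2 * star (z 2) - z 3 * star (z 3)) :
    Ψ * Ψᴴ = (1/2 : ℂ) •
      !![1 + x, 0, α, -(starRingEnd ℂ (muDef θ)) • star β;
         0, 1 + x, β, (muDef θ) • star α;
         star α, star β, 1 - x, 0;
         -((muDef θ) • β), (starRingEnd ℂ (muDef θ)) • α, 0, 1 - x] := by
  have hμ := conj_muDef_mul_muDef θ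
  have hμ' : muDef θ * starRingEnd ℂ (muDef θ) = 1 := by rw [mul_comm, hμ]
  have half (a : A) : (1 / 2 : ℂ) • (2 * a) = a := by
    rw [two_mul, ← two_smul ℂ a, smul_smul]
    norm_num
  have star_two_mul (a : A) : star (2 * a) = 2 * star a := by simp [two_mul]
  have normal (j : Fin 4) : z j * star (z j) = star (z j) * z j := by
    have h := hzs j j
    fin_cases j <;> simpa [etaDef] using h
  have h01 : z 0 * star (z 1) = star (z 1) * z 0 := by simpa [etaDef] using hzs 0 1
  have h10 : z 1 * star (z 0) = star (z 0) * z 1 := by simpa [etaDef] using hzs 1 0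
  have h23 : z 2 * star (z 3) = star (z 3) * z 2 := by simpa [etaDef] using hzs 2 3
  have h32 : z 3 * star (z 2) = star (z 2) * z 3 := by simpa [etaDef] using hzs 3 2
  have h03 : z 0 * star (z 3) = starRingEnd ℂ (muDef θ) • (star (z 3) * z 0) := by
    simpa [etaDef] using hzs 0 3
  have h30 : z 3 * star (z 0) = muDef θ • (star (z 0) * z 3) := by
    simpa [etaDef] using hzs 3 0
  have h12 : z 1 * star (z 2) = starRingEnd ℂ (muDef θ) • (star (z 2) * z 1) := by
    simpa [etaDef] using hzs 1 2
  have h21 : z 2 * star (z 1) = muDef θ • (star (z 1) * z 2) := by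
    simpa [etaDef] using hzs 2 1
  have h02 : z 0 * star (z 2) = muDef θ • (star (z 2) * z 0) := by
    simpa [etaDef] using hzs 0 2
  have h20 : z 2 * star (z 0) = starRingEnd ℂ (muDef θ) • (star (z 0) * z 2) := by
    simpa [etaDef] using hzs 2 0
  have h13 : z 1 * star (z 3) = muDef θ • (star (z 3) * z 1) := by
    simpa [etaDef] using hzs 1 3
  have h31 : z 3 * star (z 1) = starRingEnd ℂ (muDef θ) • (star (z 1) * z 3) := by
    simpa [etaDef] using hzs 3 1
  have hplus : 1 + x = 2 * (star (z 0) * z 0 + star (z 1) * z 1) := by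
    rw [hx, ← hsph]
    simp only [normal]
    noncomm_ring
  have hminus : 1 - x = 2 * (star (z 2) * z 2 + star (z 3) * z 3) := by
    rw [hx, ← hsph]
    simp only [normal]
    noncomm_ring
  rw [hplus, hminus, hΨ, hα, hβ]
  ext i j
  fin_cases i <;> fin_cases j <;>
    simp [-one_div, Matrix.mul_apply, Fin.sum_univ_two, star_two_mul,
      smul_comm (1 / 2 : ℂ), half] <;>
    simp [normal, h01, h10, h23, h32, h03, h30, h12, h21, h02, h20, h13, h31,
      smul_sub, smul_smul, hμ, hμ'] <;>
    abel
end

section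
/- Let (A; z₁,z₂,z₃,z₄) be a θ-deformed 7-sphere datum and set α := 2(z₁z₃* + z₂*z₄), β := 2(z₂z₃* − z₁*z₄), x := z₁z₁* + z₂z₂* − z₃z₃* − z₄z₄*, and λ := μ². Then: x* = x; x commutes with every z_l and every z_l* (in particular x commutes with α, β, α*, β*); the relations αβ = λβα, α*β* = λβ*α*, β*α = λαβ*, βα* = λα*β hold; and α*α + β*β + x² = 1. -/
open Matrix

/-- `u` and `v` commute up to the scalar `q`. -/
def QComm {A : Type*} [Ring A] [Algebra ℂ A] (q : ℂ) (u v : A) : Prop :=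
  u * v = q • (v * u)

namespace QComm

variable {A : Type*} [Ring A] [Algebra ℂ A] {p q : ℂ} {u v w : A}

theorem symm (h : QComm q u v) (hpq : p * q = 1) : QComm p v u := by
  unfold QComm at *
  rw [h, smul_smul, hpq, one_smul]

theorem mul_left (h₁ : QComm p u w) (h₂ : QComm q v w) : QComm (p * q) (u * v) w := by
  unfold QComm at *
  rw [mul_assoc, h₂, mul_smul_comm, ← mul_assoc, h₁, smul_mul_assoc, smul_smul, mul_assoc,
    mul_comm q p]

theorem mul_right (h₁ : QComm p u v) (h₂ : QComm q u w) : QComm (p * q) u (v * w) := by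
  unfold QComm at *
  rw [← mul_assoc, h₁, smul_mul_assoc, mul_assoc, h₂, mul_smul_comm, smul_smul, mul_assoc]

theorem add_left (h₁ : QComm q u w) (h₂ : QComm q v w) : QComm q (u + v) w := by
  unfold QComm at *
  rw [add_mul, h₁, h₂, mul_add, smul_add]

theorem sub_left (h₁ : QComm q u w) (h₂ : QComm q v w) : QComm q (u - v) w := by
  unfold QComm at *
  rw [sub_mul, h₁, h₂, mul_sub, smul_sub]

theorem add_right (h₁ : QComm q u v) (h₂ : QComm q u w) : QComm q u (v + w) := by
  unfold QComm at *
  rw [mul_add, h₁, h₂, add_mul, smul_add]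

theorem sub_right (h₁ : QComm q u v) (h₂ : QComm q u w) : QComm q u (v - w) := by
  unfold QComm at *
  rw [mul_sub, h₁, h₂, sub_mul, smul_sub]

theorem two_mul_two_mul (h : QComm q u v) : QComm q (2 * u) (2 * v) := by
  simp only [two_mul]
  exact (h.add_left h).add_right (h.add_left h)

protected theorem star [StarRing A] [StarModule ℂ A] (h : QComm q u v) :
    QComm (star q) (star v) (star u) := by
  have := congrArg star h
  rwa [star_smul, star_mul, star_mul] at this

/-- Rescaling factor for a pair of quadratic monomials. -/
theorem mul_mul {a b c d r : ℂ} {u₁ u₂ v₁ v₂ : A} (h₁₁ : QComm a u₁ v₁) (h₁₂ : QComm b u₁ v₂)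
    (h₂₁ : QComm c u₂ v₁) (h₂₂ : QComm d u₂ v₂) (hr : (a * b) * (c * d) = r) :
    QComm r (u₁ * u₂) (v₁ * v₂) :=
  hr ▸ (h₁₁.mul_right h₁₂).mul_left (h₂₁.mul_right h₂₂)

end QComm

theorem star_etaDef (θ : ℝ) (j l : Fin 4) : star (etaDef θ j l) = etaDef θ l j := by
  fin_cases j <;> fin_cases l <;> simp [etaDef]

theorem etaDef_mul_swap (θ : ℝ) (j l : Fin 4) : etaDef θ j l * etaDef θ l j = 1 := by
  have h := conj_muDef_mul_muDef θ
  have h' := (mul_comm _ _).trans h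
  fin_cases j <;> fin_cases l <;> simp [etaDef, h, h']

theorem etaDef_self (θ : ℝ) (j : Fin 4) : etaDef θ j j = 1 := by
  fin_cases j <;> simp [etaDef]

/-- For a θ-deformed 7-sphere datum, the elements α = 2(z₁z₃* + z₂*z₄),
β = 2(z₂z₃* − z₁*z₄), x = z₁z₁* + z₂z₂* − z₃z₃* − z₄z₄* satisfy: x is self-adjoint and
central among the z's (in particular commutes with α, β, α*, β*), the θ-deformed
four-sphere relations with λ = μ², and the sphere relation α*α + β*β + x² = 1. -/
theorem stmt2 (θ : ℝ) (A : Type*) [Ring A] [Algebra ℂ A] [StarRing A] [StarModule ℂ A]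
    (z : Fin 4 → A)
    (hzz : ∀ j l, z j * z l = etaDef θ j l • (z l * z j))
    (hzs : ∀ j l, z j * star (z l) = etaDef θ l j • (star (z l) * z j))
    (hsph : star (z 0) * z 0 + star (z 1) * z 1 + star (z 2) * z 2 + star (z 3) * z 3 = 1)
    (α β x : A)
    (hα : α = 2 * (z 0 * star (z 2) + star (z 1) * z 3))
    (hβ : β = 2 * (z 1 * star (z 2) - star (z 0) * z 3))
    (hx : x = z 0 * star (z 0) + z 1 * star (z 1) - z 2 * star (z 2) - z 3 * star (z 3)) :
    star x = x ∧
    (∀ l, x * z l = z l * x) ∧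
    (∀ l, x * star (z l) = star (z l) * x) ∧
    (x * α = α * x ∧ x * β = β * x ∧ x * star α = star α * x ∧ x * star β = star β * x) ∧
    α * β = (muDef θ ^ 2) • (β * α) ∧
    star α * star β = (muDef θ ^ 2) • (star β * star α) ∧
    star β * α = (muDef θ ^ 2) • (α * star β) ∧
    β * star α = (muDef θ ^ 2) • (star α * β) ∧
    star α * α + star β * β + x * x = 1 := by
  have qzz (j l) : QComm (etaDef θ j l) (z j) (z l) := hzz j l
  have qzs (j l) : QComm (etaDef θ l j) (z j) (star (z l)) := hzs j l
  have qsz (j l) : QComm (etaDef θ l j) (star (z j)) (z l) :=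
    (qzs l j).symm (etaDef_mul_swap θ l j)
  have qss (j l) : QComm (etaDef θ j l) (star (z j)) (star (z l)) :=
    star_etaDef θ l j ▸ (qzz l j).star
  have comm_of {u v : A} (h : QComm 1 u v) : u * v = v * u := by
    rw [h, one_smul]
  have hrz (j l) : QComm 1 (z j * star (z j)) (z l) :=
    etaDef_mul_swap θ j l ▸ (qzz j l).mul_left (qsz j l)
  have hrs (j l) : QComm 1 (z j * star (z j)) (star (z l)) :=
    etaDef_mul_swap θ l j ▸ (qzs j l).mul_left (qss j l)
  have hxs : star x = x := by
    simp [hx]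
  have hxz (l) : x * z l = z l * x := by
    rw [hx]
    exact comm_of ((((hrz 0 l).add_left (hrz 1 l)).sub_left (hrz 2 l)).sub_left (hrz 3 l))
  have hxz' (l) : x * star (z l) = star (z l) * x := by
    rw [hx]
    exact comm_of ((((hrs 0 l).add_left (hrs 1 l)).sub_left (hrs 2 l)).sub_left (hrs 3 l))
  have cz (l) : Commute x (z l) := hxz l
  have cs (l) : Commute x (star (z l)) := hxz' l
  have c2 : Commute x 2 := Commute.ofNat_right x 2
  have hα' : star α = 2 * (z 2 * star (z 0) + star (z 3) * z 1) := by
    simp [hα, two_mul]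
  have hβ' : star β = 2 * (z 2 * star (z 1) - star (z 3) * z 0) := by
    simp [hβ, two_mul]
  have hnorm (j) : star (z j) * z j = z j * star (z j) := by
    have h := hzs j j
    rw [etaDef_self, one_smul] at h
    exact h.symm
  refine ⟨hxs, hxz, hxz', ⟨?_, ?_, ?_, ?_⟩, ?_, ?_, ?_, ?_, ?_⟩
  · rw [hα]
    exact c2.mul_right (((cz 0).mul_right (cs 2)).add_right ((cs 1).mul_right (cz 3)))
  · rw [hβ]
    exact c2.mul_right (((cz 1).mul_right (cs 2)).sub_right ((cs 0).mul_right (cz 3)))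
  · rw [hα']
    exact c2.mul_right (((cz 2).mul_right (cs 0)).add_right ((cs 3).mul_right (cz 1)))
  · rw [hβ']
    exact c2.mul_right (((cz 2).mul_right (cs 1)).sub_right ((cs 3).mul_right (cz 0)))
  · rw [hα, hβ]
    refine QComm.two_mul_two_mul (.add_left
      (.sub_right
        (.mul_mul (qzz 0 1) (qzs 0 2) (qsz 2 1) (qss 2 2) ?_)
        (.mul_mul (qzs 0 0) (qzz 0 3) (qss 2 0) (qsz 2 3) ?_))
      (.sub_right
        (.mul_mul (qsz 1 1) (qss 1 2) (qzz 3 1) (qzs 3 2) ?_)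
        (.mul_mul (qss 1 0) (qsz 1 3) (qzs 3 0) (qzz 3 3) ?_))) <;>
    simp [etaDef] <;> ring
  · rw [hα', hβ']
    refine QComm.two_mul_two_mul (.add_left
      (.sub_right
        (.mul_mul (qzz 2 2) (qzs 2 1) (qsz 0 2) (qss 0 1) ?_)
        (.mul_mul (qzs 2 3) (qzz 2 0) (qss 0 3) (qsz 0 0) ?_))
      (.sub_right
        (.mul_mul (qsz 3 2) (qss 3 1) (qzz 1 2) (qzs 1 1) ?_)
        (.mul_mul (qss 3 3) (qsz 3 0) (qzs 1 3) (qzz 1 0) ?_))) <;>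
    simp [etaDef] <;> ring
  · rw [hβ', hα]
    refine QComm.two_mul_two_mul (.sub_left
      (.add_right
        (.mul_mul (qzz 2 0) (qzs 2 2) (qsz 1 0) (qss 1 2) ?_)
        (.mul_mul (qzs 2 1) (qzz 2 3) (qss 1 1) (qsz 1 3) ?_))
      (.add_right
        (.mul_mul (qsz 3 0) (qss 3 2) (qzz 0 0) (qzs 0 2) ?_)
        (.mul_mul (qss 3 1) (qsz 3 3) (qzs 0 1) (qzz 0 3) ?_))) <;>
    simp [etaDef] <;> ring
  · rw [hβ, hα']
    refine QComm.two_mul_two_mul (.sub_left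
      (.add_right
        (.mul_mul (qzz 1 2) (qzs 1 0) (qsz 2 2) (qss 2 0) ?_)
        (.mul_mul (qzs 1 3) (qzz 1 1) (qss 2 3) (qsz 2 1) ?_))
      (.add_right
        (.mul_mul (qsz 0 2) (qss 0 0) (qzz 3 2) (qzs 3 0) ?_)
        (.mul_mul (qss 0 3) (qsz 0 1) (qzs 3 3) (qzz 3 1) ?_))) <;>
    simp [etaDef] <;> ring
  · have c (j l) : z j * (z l * star (z l)) * star (z j)
        = (z l * star (z l)) * (z j * star (z j)) := by
      rw [← comm_of (hrz l j), mul_assoc]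
    have c' (j l) : star (z j) * (z l * star (z l)) * z j
        = (z l * star (z l)) * (z j * star (z j)) := by
      rw [← comm_of (hrs l j), mul_assoc, hnorm]
    have hz01 : z 1 * z 0 = z 0 * z 1 := by simpa [etaDef] using hzz 1 0
    have hs01 : star (z 1) * star (z 0) = star (z 0) * star (z 1) := by
      rw [← star_mul, ← star_mul, hz01]
    set R := z 0 * star (z 0) + z 1 * star (z 1) with hR
    set S := z 2 * star (z 2) + z 3 * star (z 3) with hS
    have hRS : S = 1 - R := by
      rw [← hsph, hnorm, hnorm, hnorm, hnorm, hR, hS]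
      abel
    have hαβ : star α * α + star β * β = 4 * (R * S) := by
      have e : star α * α + star β * β =
          4 * (z 2 * (star (z 0) * z 0) * star (z 2) + star (z 3) * (z 1 * star (z 1)) * z 3
            + z 2 * (star (z 1) * z 1) * star (z 2) + star (z 3) * (z 0 * star (z 0)) * z 3
            + z 2 * (star (z 0) * star (z 1) - star (z 1) * star (z 0)) * z 3
            + star (z 3) * (z 1 * z 0 - z 0 * z 1) * star (z 2)) := by
        rw [hα', hβ', hα, hβ]
        noncomm_ring
      rw [e, hnorm, hnorm, c, c, c', c', hz01, hs01, hR, hS]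
      noncomm_ring
    have hxR : x = R - S := by
      rw [hx, hS]
      abel
    rw [hαβ, hxR, hRS]
    noncomm_ring
end

section
/- Let B and C be unital associative ℂ-algebras, k ≥ 1, n = 2k+2. Let û₁,…,û_k ∈ C be pairwise commuting elements each of which commutes with given elements z₁,z₂,z₃,z₄ ∈ C satisfying z_α z_β = η_{αβ} z_β z_α. Suppose elements M^α_{ab} ∈ B (α ∈ {1,…,4}, a ∈ {1,…,n}, b ∈ {1,…,k}) satisfy the commutation relations M^α_{ab} M^β_{cd} = η_{βα} M^β_{cd} M^α_{ab} for all indices. Then the elements X_a := Σ_{b,α} M^α_{ab} ⊗ (û_b z_α) of the tensor product algebra B ⊗_ℂ C pairwise commute: X_a X_c = X_c X_a for all a, c ∈ {1,…,n} (so the monad map σ_z dualises to an algebra homomorphism on the commutative polynomial algebra in the dual basis of K). -/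
open Matrix
open scoped TensorProduct

/-- The deformation parameter has unit modulus. -/
theorem muDef_mul_conj (θ : ℝ) : muDef θ * starRingEnd ℂ (muDef θ) = 1 := by
  rw [muDef, ← Complex.exp_conj, ← Complex.exp_add]
  simp

/-- The matrix of deformation parameters satisfies `η_{jl} η_{lj} = 1`. -/
theorem etaDef_mul_etaDef_swap (θ : ℝ) (i j : Fin 4) : etaDef θ i j * etaDef θ j i = 1 := by
  have h := muDef_mul_conj θ
  have h' := mul_comm (muDef θ) (starRingEnd ℂ (muDef θ)) ▸ h
  fin_cases i <;> fin_cases j <;> simp [etaDef, h, h']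

/-- Pure tensors commute when the factors commute up to mutually inverse scalars. -/
theorem commute_tmul_of_mul_eq_smul {R B C : Type*} [CommRing R] [Ring B] [Algebra R B]
    [Ring C] [Algebra R C] {r s : R} (hrs : r * s = 1) {x x' : B} {y y' : C}
    (hx : x * x' = r • (x' * x)) (hy : y * y' = s • (y' * y)) :
    Commute (x ⊗ₜ[R] y) (x' ⊗ₜ[R] y') := by
  rw [commute_iff_eq, Algebra.TensorProduct.tmul_mul_tmul, Algebra.TensorProduct.tmul_mul_tmul,
    hx, hy, TensorProduct.smul_tmul, smul_smul, hrs, one_smul]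

/-- If the matrix elements M^α_{ab} satisfy the relations
M^α_{ab} M^β_{cd} = η_{βα} M^β_{cd} M^α_{ab}, then the elements
X_a = Σ_{b,α} M^α_{ab} ⊗ (û_b z_α) of B ⊗ C pairwise commute. -/
theorem stmt3 (θ : ℝ) (B C : Type*) [Ring B] [Algebra ℂ B] [Ring C] [Algebra ℂ C]
    (k : ℕ) (hk : 1 ≤ k)
    (u : Fin k → C) (z : Fin 4 → C)
    (huu : ∀ b d, u b * u d = u d * u b)
    (huz : ∀ b γ, u b * z γ = z γ * u b)
    (hzz : ∀ γ δ, z γ * z δ = etaDef θ γ δ • (z δ * z γ))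
    (M : Fin 4 → Fin (2 * k + 2) → Fin k → B)
    (hM : ∀ γ δ a b c d, M γ a b * M δ c d = etaDef θ δ γ • (M δ c d * M γ a b)) :
    ∀ a c : Fin (2 * k + 2),
      (∑ b, ∑ γ, M γ a b ⊗ₜ[ℂ] (u b * z γ) : B ⊗[ℂ] C) * (∑ b, ∑ γ, M γ c b ⊗ₜ[ℂ] (u b * z γ))
        = (∑ b, ∑ γ, M γ c b ⊗ₜ[ℂ] (u b * z γ)) * (∑ b, ∑ γ, M γ a b ⊗ₜ[ℂ] (u b * z γ)) := by
  intro a c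
  refine Commute.sum_left _ _ _ fun b _ => Commute.sum_left _ _ _ fun γ _ =>
    Commute.sum_right _ _ _ fun d _ => Commute.sum_right _ _ _ fun δ _ =>
      commute_tmul_of_mul_eq_smul (etaDef_mul_etaDef_swap θ δ γ) (hM γ δ a b c d) ?_
  calc u b * z γ * (u d * z δ) = u b * u d * (z γ * z δ) :=
        (show Commute (z γ) (u d) from (huz d γ).symm).mul_mul_mul_comm _ _
    _ = etaDef θ γ δ • (u d * u b * (z δ * z γ)) := by
        rw [hzz γ δ, huu b d, mul_smul_comm]
    _ = etaDef θ γ δ • (u d * z δ * (u b * z γ)) := by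
        rw [(show Commute (u b) (z δ) from huz b δ).mul_mul_mul_comm]
end

section
/- Let R be a unital ℂ-algebra with a conjugate-linear involutive anti-automorphism r ↦ r*, containing elements z₁,z₂,z₃,z₄ with z_j z_l = η_{jl} z_l z_j and z_j z_l* = η_{lj} z_l* z_j, and elements M^α_{ab} (α ∈ {1,…,4}, a ∈ {1,…,n}, b ∈ {1,…,k}) such that every M^α_{ab} and every (M^α_{ab})* commutes with every z_γ and every z_γ*. Define n×k matrices over R: σ_z with entries (σ_z)_{ab} = Σ_α M^α_{ab} z_α, and σ_{J(z)} with entries (σ_{J(z)})_{ab} = −M¹_{ab} z₂* + M²_{ab} z₁* − M³_{ab} z₄* + M⁴_{ab} z₃*. Set (N¹,N²,N³,N⁴) := (−(M²)^†, (M¹)^†, −(M⁴)^†, (M³)^†) where X^† is the conjugate transpose, and assume the self-dual ADHM relations N^α M^β + η_{βα} N^β M^α = 0 for all α,β ∈ {1,…,4}. Then σ_{J(z)}^★ σ_z = 0, σ_z^★ σ_{J(z)} = 0, and σ_z^★ σ_z = σ_{J(z)}^★ σ_{J(z)} (identities of k×k matrices over R). -/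
open Matrix

theorem mul_scalar_apply {R m n : Type*} [Semiring R] [Fintype n] [DecidableEq n]
    (A : Matrix m n R) (w : R) (a : m) (b : n) : (A * scalar n w) a b = A a b * w := by
  rw [scalar_apply, mul_diagonal]

theorem scalar_smul {S R n : Type*} [Semiring R] [Fintype n] [DecidableEq n]
    [SMulZeroClass S R] (c : S) (w : R) : scalar n (c • w) = c • scalar n w := by
  rw [scalar_apply, scalar_apply, ← diagonal_smul]
  rfl

/-- Scalars on the right commuting with the entries may be collected in a product. -/
theorem conjTranspose_mul_scalar_mul {R : Type*} [Ring R] [StarRing R] {n k : ℕ}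
    (A B : Matrix (Fin n) (Fin k) R) (u v : R)
    (hA : ∀ a b, star (A a b) * star u = star u * star (A a b))
    (hB : ∀ a b, B a b * star u = star u * B a b) :
    (A * scalar (Fin k) u)ᴴ * (B * scalar (Fin k) v) =
      Aᴴ * B * scalar (Fin k) (star u * v) := by
  ext a b
  rw [mul_scalar_apply, Matrix.mul_apply, Matrix.mul_apply, Finset.sum_mul]
  refine Finset.sum_congr rfl fun c _ => ?_
  rw [conjTranspose_apply, mul_scalar_apply, mul_scalar_apply, conjTranspose_apply, star_mul, ← hA,
    mul_assoc, ← mul_assoc (star u), ← hB]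
  simp only [mul_assoc]

/-- A sum of products of twisted antisymmetric and twisted symmetric families vanishes. -/
theorem sum_mul_eq_zero_of_twisted {ι A : Type*} [Fintype ι] [Ring A] [Algebra ℂ A]
    (c : ι → ι → ℂ) (Q W : ι → ι → A)
    (hQ : ∀ i j, Q i j + c j i • Q j i = 0) (hW : ∀ i j, W i j = c i j • W j i) :
    ∑ i, ∑ j, Q i j * W i j = 0 := by
  have h : ∑ i, ∑ j, Q i j * W i j = -∑ i, ∑ j, Q i j * W i j := by
    conv_rhs => rw [Finset.sum_comm]
    simp only [← Finset.sum_neg_distrib]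
    refine Finset.sum_congr rfl fun i _ => Finset.sum_congr rfl fun j _ => ?_
    rw [eq_neg_of_add_eq_zero_left (hQ i j), hW j i, neg_mul, smul_mul_assoc, mul_smul_comm]
  have h2 : (2 : ℂ) • ∑ i, ∑ j, Q i j * W i j = 0 := by
    rw [two_smul]
    exact add_eq_zero_iff_eq_neg.mpr h
  exact (smul_eq_zero_iff_right two_ne_zero).mp h2

/-- Under the self-dual ADHM relations N^α M^β + η_{βα} N^β M^α = 0
with (N¹,N²,N³,N⁴) = (−(M²)†, (M¹)†, −(M⁴)†, (M³)†), the matrices σ_z and σ_{J(z)}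
satisfy σ_{J(z)}^★ σ_z = 0, σ_z^★ σ_{J(z)} = 0 and σ_z^★ σ_z = σ_{J(z)}^★ σ_{J(z)}. -/
theorem stmt6 (θ : ℝ) (R : Type*) [Ring R] [Algebra ℂ R] [StarRing R] [StarModule ℂ R]
    (n k : ℕ) (z : Fin 4 → R)
    (hzz : ∀ j l, z j * z l = etaDef θ j l • (z l * z j))
    (hzs : ∀ j l, z j * star (z l) = etaDef θ l j • (star (z l) * z j))
    (M : Fin 4 → Matrix (Fin n) (Fin k) R)
    (hMz : ∀ γ a b δ, M γ a b * z δ = z δ * M γ a b)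
    (hMzs : ∀ γ a b δ, M γ a b * star (z δ) = star (z δ) * M γ a b)
    (hMsz : ∀ γ a b δ, star (M γ a b) * z δ = z δ * star (M γ a b))
    (hMszs : ∀ γ a b δ, star (M γ a b) * star (z δ) = star (z δ) * star (M γ a b))
    (N : Fin 4 → Matrix (Fin k) (Fin n) R)
    (hN0 : N 0 = -(M 1)ᴴ) (hN1 : N 1 = (M 0)ᴴ) (hN2 : N 2 = -(M 3)ᴴ) (hN3 : N 3 = (M 2)ᴴ)
    (hADHM : ∀ γ δ, N γ * M δ + etaDef θ δ γ • (N δ * M γ) = 0)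
    (σ σJ : Matrix (Fin n) (Fin k) R)
    (hσ : ∀ a b, σ a b = ∑ γ, M γ a b * z γ)
    (hσJ : ∀ a b, σJ a b = -(M 0 a b * star (z 1)) + M 1 a b * star (z 0)
        - M 2 a b * star (z 3) + M 3 a b * star (z 2)) :
    σJᴴ * σ = 0 ∧ σᴴ * σJ = 0 ∧ σᴴ * σ = σJᴴ * σJ := by
  have hσM : σ = ∑ γ, M γ * scalar (Fin k) (z γ) := by
    ext a b
    simp only [hσ, Matrix.sum_apply, mul_scalar_apply]
  have hσJM : σJ = -(M 0 * scalar (Fin k) (star (z 1))) + (M 1 * scalar (Fin k) (star (z 0)))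
      - (M 2 * scalar (Fin k) (star (z 3))) + (M 3 * scalar (Fin k) (star (z 2))) := by
    ext a b
    simp only [hσJ, Matrix.add_apply, Matrix.sub_apply, Matrix.neg_apply, mul_scalar_apply]
  have h₁ : ∀ γ δ u v, (M γ * scalar (Fin k) (z u))ᴴ * (M δ * scalar (Fin k) v) =
      (M γ)ᴴ * M δ * scalar (Fin k) (star (z u) * v) := fun γ δ u v =>
    conjTranspose_mul_scalar_mul _ _ _ _ (fun a b => hMszs γ a b u) (fun a b => hMzs δ a b u)
  have h₂ : ∀ γ δ u v, (M γ * scalar (Fin k) (star (z u)))ᴴ * (M δ * scalar (Fin k) v) =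
      (M γ)ᴴ * M δ * scalar (Fin k) (z u * v) := fun γ δ u v => by
    rw [conjTranspose_mul_scalar_mul, star_star]
    · simpa only [star_star] using fun a b => hMsz γ a b u
    · simpa only [star_star] using fun a b => hMz δ a b u
  have hJ : σJᴴ * σ = 0 := by
    have key := sum_mul_eq_zero_of_twisted (etaDef θ) (fun γ δ => N γ * M δ)
      (fun γ δ => scalar (Fin k) (z γ * z δ)) hADHM
      (fun γ δ => by rw [hzz γ δ]; exact scalar_smul _ _)
    rw [← neg_eq_zero, ← key, hσM, hσJM]
    simp only [Fin.sum_univ_four, hN0, hN1, hN2, hN3, conjTranspose_add, conjTranspose_sub,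
      conjTranspose_neg, Matrix.add_mul, Matrix.sub_mul, Matrix.neg_mul,
      Matrix.mul_add, h₂]
    abel
  refine ⟨hJ, by simpa using congrArg conjTranspose hJ, ?_⟩
  have hμ := conj_muDef_mul_muDef θ
  have hμ' : muDef θ * starRingEnd ℂ (muDef θ) = 1 := by rw [mul_comm, hμ]
  have hd : ∀ j l, scalar (Fin k) (z j * star (z l)) =
      etaDef θ l j • scalar (Fin k) (star (z l) * z j) := fun j l => by
    rw [hzs j l]; exact scalar_smul _ _
  have hself : ∀ γ, N γ * M γ = 0 := fun γ => by
    have h : etaDef θ γ γ = 1 := by fin_cases γ <;> rfl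
    have h' := hADHM γ γ
    rw [h, one_smul, ← two_smul ℂ] at h'
    exact (smul_eq_zero_iff_right two_ne_zero).mp h'
  have p10 : (M 1)ᴴ * M 0 = 0 := by simpa [hN0] using hself 0
  have p01 : (M 0)ᴴ * M 1 = 0 := by simpa [hN1] using hself 1
  have p32 : (M 3)ᴴ * M 2 = 0 := by simpa [hN2] using hself 2
  have p23 : (M 2)ᴴ * M 3 = 0 := by simpa [hN3] using hself 3
  have p00 : (M 0)ᴴ * M 0 = (M 1)ᴴ * M 1 := by
    have h := hADHM 1 0
    simp only [etaDef, hN1, hN0] at h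
    simpa [add_eq_zero_iff_eq_neg] using h
  have p22 : (M 2)ᴴ * M 2 = (M 3)ᴴ * M 3 := by
    have h := hADHM 3 2
    simp only [etaDef, hN3, hN2] at h
    simpa [add_eq_zero_iff_eq_neg] using h
  have p02 : (M 0)ᴴ * M 2 = starRingEnd ℂ (muDef θ) • ((M 3)ᴴ * M 1) := by
    have h := hADHM 1 2
    simp only [etaDef, hN1, hN2] at h
    simpa [add_eq_zero_iff_eq_neg] using h
  have p03 : (M 0)ᴴ * M 3 = -(muDef θ • ((M 2)ᴴ * M 1)) := by
    have h := hADHM 1 3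
    simp only [etaDef, hN1, hN3] at h
    simpa [add_eq_zero_iff_eq_neg] using h
  have p12 : (M 1)ᴴ * M 2 = -(muDef θ • ((M 3)ᴴ * M 0)) := by
    have h := hADHM 0 2
    simp only [etaDef, hN0, hN2] at h
    simpa [add_eq_zero_iff_eq_neg, neg_eq_iff_eq_neg] using h
  have p13 : (M 1)ᴴ * M 3 = starRingEnd ℂ (muDef θ) • ((M 2)ᴴ * M 0) := by
    have h := hADHM 0 3
    simp only [etaDef, hN0, hN3] at h
    simpa [add_eq_zero_iff_eq_neg] using h
  rw [hσM, hσJM]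
  simp only [Fin.sum_univ_four, conjTranspose_add, conjTranspose_sub, conjTranspose_neg,
    Matrix.add_mul, Matrix.sub_mul, Matrix.neg_mul, Matrix.mul_add, Matrix.mul_sub, Matrix.mul_neg,
    h₁, h₂, hd, p10, p01, p32, p23, p00, p22, p02, p03, p12, p13]
  simp [-scalar_apply, etaDef, smul_smul, hμ, hμ']
  abel
end

section
/- Let R be a unital ring with an involution r ↦ r* (an additive, involutive anti-automorphism). Let σ be an n×k matrix over R and ρ' a k×k matrix over R such that: (i) every entry of ρ' commutes with every entry of σ and with the star of every entry of σ; (ii) for each row index μ and all column indices r,s, the entries σ_{μr} and (σ_{μs})* commute; and (iii) σ^★ σ ρ' = I_k, where σ^★ is the conjugate transpose and I_k the k×k identity matrix. Then the trace of the n×n matrix σ ρ' σ^★ equals k·1_R. -/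
open Matrix

/-- If σ is an n×k matrix and ρ' a k×k matrix over a unital ring with
involution such that the entries of ρ' commute with the entries of σ and their stars,
entries of σ in a common row commute with the stars of entries in that row, and
σ^★ σ ρ' = I_k, then the trace of σ ρ' σ^★ equals k·1. -/
theorem stmt8 (R : Type*) [Ring R] [StarRing R] (n k : ℕ)
    (σ : Matrix (Fin n) (Fin k) R) (ρ' : Matrix (Fin k) (Fin k) R)
    (hcomm : ∀ (i j : Fin k) (a : Fin n) (b : Fin k), ρ' i j * σ a b = σ a b * ρ' i j)
    (hcomms : ∀ (i j : Fin k) (a : Fin n) (b : Fin k),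
      ρ' i j * star (σ a b) = star (σ a b) * ρ' i j)
    (hrow : ∀ (m : Fin n) (r s : Fin k), σ m r * star (σ m s) = star (σ m s) * σ m r)
    (hinv : σᴴ * σ * ρ' = 1) :
    (σ * ρ' * σᴴ).trace = (k : R) := by
  have htrace : (σ * ρ' * σᴴ).trace = (σᴴ * σ * ρ').trace := by
    simp only [trace, diag_apply, mul_apply, conjTranspose_apply, Finset.sum_mul]
    rw [Finset.sum_comm]
    refine Finset.sum_congr rfl fun s _ => ?_
    rw [Finset.sum_comm]
    refine Finset.sum_congr rfl fun r _ => Finset.sum_congr rfl fun m _ => ?_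
    rw [mul_assoc, hcomms, ← mul_assoc, hrow]
  rw [htrace, hinv, trace_one, Fintype.card_fin]
end

section
/- Let R be a unital ring with an involution r ↦ r*, let k ≥ 1 and n = 2k+2. Let σ and σ' be n×k matrices over R and ρ' a k×k matrix over R such that: ρ'^★ = ρ'; σ^★σ = σ'^★σ' =: ρ²; σ'^★σ = 0; ρ²ρ' = ρ'ρ² = I_k; every entry of ρ' commutes with every entry of σ and σ' and with the stars of these entries; and for each row index μ and all r,s, σ_{μr} commutes with (σ_{μs})* and σ'_{μr} commutes with (σ'_{μs})*. Then Q := σρ'σ^★ + σ'ρ'σ'^★ ∈ M_n(R) satisfies Q^★ = Q = Q² and trace(Q) = 2k·1_R, and the matrices Q_z := σρ'σ^★ and Q_{J(z)} := σ'ρ'σ'^★ are projections with Q_{J(z)} Q_z = 0 = Q_z Q_{J(z)}; consequently P := I_n − Q satisfies P^★ = P = P² and trace(P) = 2·1_R. -/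
open Matrix

section Projection

variable {R m n : Type*} [Ring R] [StarRing R] [Fintype n]

theorem conjTranspose_mul_mul_conjTranspose_of_isHermitian {ρ : Matrix n n R}
    (hρ : ρᴴ = ρ) (σ : Matrix m n R) : (σ * ρ * σᴴ)ᴴ = σ * ρ * σᴴ := by
  simp only [conjTranspose_mul, conjTranspose_conjTranspose, hρ, Matrix.mul_assoc]

theorem mul_self_of_mul_gram_eq_one [Fintype m] [DecidableEq n] {σ : Matrix m n R} {ρ : Matrix n n R}
    (h : ρ * (σᴴ * σ) = 1) : (σ * ρ * σᴴ) * (σ * ρ * σᴴ) = σ * ρ * σᴴ := by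
  calc (σ * ρ * σᴴ) * (σ * ρ * σᴴ) = σ * (ρ * (σᴴ * σ)) * (ρ * σᴴ) := by
        simp only [Matrix.mul_assoc]
    _ = σ * ρ * σᴴ := by rw [h, Matrix.mul_one, Matrix.mul_assoc]

theorem mul_eq_zero_of_conjTranspose_mul_eq_zero [Fintype m] {σ τ : Matrix m n R}
    (ρ : Matrix n n R) (h : τᴴ * σ = 0) : (τ * ρ * τᴴ) * (σ * ρ * σᴴ) = 0 := by
  calc (τ * ρ * τᴴ) * (σ * ρ * σᴴ) = τ * ρ * (τᴴ * σ) * (ρ * σᴴ) := by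
        simp only [Matrix.mul_assoc]
    _ = 0 := by rw [h, Matrix.mul_zero, Matrix.zero_mul]

/-- Cyclicity of the trace for `σ * ρ * σᴴ` over a noncommutative ring, given that the entries
involved commute. -/
theorem trace_mul_mul_conjTranspose [Fintype m] {σ : Matrix m n R} {ρ : Matrix n n R}
    (hc : ∀ i j a b, ρ i j * σ a b = σ a b * ρ i j)
    (hrow : ∀ a r s, σ a r * star (σ a s) = star (σ a s) * σ a r) :
    (σ * ρ * σᴴ).trace = (ρ * (σᴴ * σ)).trace := by
  simp only [Matrix.trace, Matrix.diag_apply, Matrix.mul_apply, conjTranspose_apply,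
    Finset.sum_mul, Finset.mul_sum]
  calc ∑ a, ∑ s, ∑ r, σ a r * ρ r s * star (σ a s)
      = ∑ a, ∑ r, ∑ s, ρ r s * (star (σ a s) * σ a r) := by
        refine Finset.sum_congr rfl fun a _ => ?_
        rw [Finset.sum_comm]
        refine Finset.sum_congr rfl fun r _ => Finset.sum_congr rfl fun s _ => ?_
        rw [← hc, mul_assoc, hrow]
    _ = ∑ r, ∑ s, ∑ a, ρ r s * (star (σ a s) * σ a r) := by
        rw [Finset.sum_comm]
        exact Finset.sum_congr rfl fun r _ => Finset.sum_comm

end Projection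

/-- With σ, σ' the two halves of the ADHM matrix V = (σ_z, σ_{J(z)}) and
ρ' playing the role of ρ^{-2}, the matrix Q = σρ'σ^★ + σ'ρ'σ'^★ is a self-adjoint
idempotent of trace 2k, the summands Q_z = σρ'σ^★ and Q_{J(z)} = σ'ρ'σ'^★ are mutually
orthogonal projections, and P = I − Q is a self-adjoint idempotent of trace 2. -/
theorem stmt9 (R : Type*) [Ring R] [StarRing R] (k : ℕ) (hk : 1 ≤ k)
    (σ σ' : Matrix (Fin (2 * k + 2)) (Fin k) R) (ρ' : Matrix (Fin k) (Fin k) R)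
    (hρ : ρ'ᴴ = ρ')
    (hσσ : σᴴ * σ = σ'ᴴ * σ')
    (horth : σ'ᴴ * σ = 0)
    (hinv1 : σᴴ * σ * ρ' = 1) (hinv2 : ρ' * (σᴴ * σ) = 1)
    (hc1 : ∀ (i j : Fin k) (a : Fin (2 * k + 2)) (b : Fin k),
      ρ' i j * σ a b = σ a b * ρ' i j)
    (hc2 : ∀ (i j : Fin k) (a : Fin (2 * k + 2)) (b : Fin k),
      ρ' i j * σ' a b = σ' a b * ρ' i j)
    (hc3 : ∀ (i j : Fin k) (a : Fin (2 * k + 2)) (b : Fin k),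
      ρ' i j * star (σ a b) = star (σ a b) * ρ' i j)
    (hc4 : ∀ (i j : Fin k) (a : Fin (2 * k + 2)) (b : Fin k),
      ρ' i j * star (σ' a b) = star (σ' a b) * ρ' i j)
    (hrow : ∀ (m : Fin (2 * k + 2)) (r s : Fin k),
      σ m r * star (σ m s) = star (σ m s) * σ m r)
    (hrow' : ∀ (m : Fin (2 * k + 2)) (r s : Fin k),
      σ' m r * star (σ' m s) = star (σ' m s) * σ' m r)
    (Qz Qj Q P : Matrix (Fin (2 * k + 2)) (Fin (2 * k + 2)) R)
    (hQz : Qz = σ * ρ' * σᴴ) (hQj : Qj = σ' * ρ' * σ'ᴴ)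
    (hQ : Q = Qz + Qj) (hP : P = 1 - Q) :
    Qᴴ = Q ∧ Q * Q = Q ∧ Q.trace = ((2 * k : ℕ) : R) ∧
    Qzᴴ = Qz ∧ Qz * Qz = Qz ∧ Qjᴴ = Qj ∧ Qj * Qj = Qj ∧
    Qj * Qz = 0 ∧ Qz * Qj = 0 ∧
    Pᴴ = P ∧ P * P = P ∧ P.trace = (2 : R) := by
  have hinv : ρ' * (σ'ᴴ * σ') = 1 := hσσ ▸ hinv2
  have hz : Qzᴴ = Qz := hQz ▸ conjTranspose_mul_mul_conjTranspose_of_isHermitian hρ σ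
  have hj : Qjᴴ = Qj := hQj ▸ conjTranspose_mul_mul_conjTranspose_of_isHermitian hρ σ'
  have hzz : Qz * Qz = Qz := hQz ▸ mul_self_of_mul_gram_eq_one hinv2
  have hjj : Qj * Qj = Qj := hQj ▸ mul_self_of_mul_gram_eq_one hinv
  have hjz : Qj * Qz = 0 := by
    rw [hQj, hQz, mul_eq_zero_of_conjTranspose_mul_eq_zero ρ' horth]
  have hzj : Qz * Qj = 0 := by
    simpa [hz, hj] using congrArg conjTranspose hjz
  have hQstar : Qᴴ = Q := by rw [hQ, conjTranspose_add, hz, hj]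
  have hQQ : Q * Q = Q := by
    rw [hQ, add_mul, mul_add, mul_add, hzz, hjj, hjz, hzj, add_zero, zero_add]
  have htr : Q.trace = ((2 * k : ℕ) : R) := by
    rw [hQ, trace_add, hQz, hQj, trace_mul_mul_conjTranspose hc1 hrow,
      trace_mul_mul_conjTranspose hc2 hrow', hinv2, hinv, trace_one, Fintype.card_fin,
      two_mul, Nat.cast_add]
  refine ⟨hQstar, hQQ, htr, hz, hzz, hj, hjj, hjz, hzj, ?_, ?_, ?_⟩
  · rw [hP, conjTranspose_sub, conjTranspose_one, hQstar]
  · rw [hP]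
    exact (show IsIdempotentElem Q from hQQ).one_sub
  · rw [hP, trace_sub, htr, trace_one, Fintype.card_fin, Nat.cast_add, Nat.cast_ofNat,
      add_sub_cancel_left]
end

section
/- Let R be a unital ring with an involution r ↦ r*, k ≥ 1, n = 2k+2. Let σ, σ' be n×k matrices over R, and ρ', ρ₁ k×k matrices over R such that: ρ'^★ = ρ', ρ₁^★ = ρ₁, ρ₁² = ρ' (as matrices), ρ₁ρ² = ρ²ρ₁ where ρ² := σ^★σ; σ^★σ = σ'^★σ' = ρ²; σ'^★σ = 0; ρ²ρ' = ρ'ρ² = I_k; and every entry of ρ' and of ρ₁ commutes with every entry of σ and σ' and with the stars of these entries. For each l ∈ {1,…,k}, let Ψ̃_l be the n×2 matrix whose first column is the l-th column of σρ₁ and whose second column is the l-th column of σ'ρ₁. Then Ψ̃_l^★ Ψ̃_l = I₂ for each l, and Σ_{l=1}^{k} Ψ̃_l Ψ̃_l^★ = σρ'σ^★ + σ'ρ'σ'^★; i.e., the rank-2k projection Q decomposes as a sum of k mutually complementary rank-2 projections Q_l = Ψ̃_l Ψ̃_l^★. -/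
open Matrix

/-- With ρ₁ playing the role of ρ^{-1} and ρ' = ρ₁² that of ρ^{-2},
the n×2 matrices Ψ̃_l (whose columns are the l-th columns of σρ₁ and σ'ρ₁) satisfy
Ψ̃_l^★ Ψ̃_l = I₂, and Σ_l Ψ̃_l Ψ̃_l^★ = σρ'σ^★ + σ'ρ'σ'^★; i.e. the rank-2k ADHM
projection Q decomposes as a sum of k rank-2 projections. -/
theorem stmt10 (R : Type*) [Ring R] [StarRing R] (k : ℕ) (hk : 1 ≤ k)
    (σ σ' : Matrix (Fin (2 * k + 2)) (Fin k) R) (ρ' ρ₁ : Matrix (Fin k) (Fin k) R)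
    (hρ' : ρ'ᴴ = ρ') (hρ₁ : ρ₁ᴴ = ρ₁) (hsq : ρ₁ * ρ₁ = ρ')
    (hcommρ : ρ₁ * (σᴴ * σ) = (σᴴ * σ) * ρ₁)
    (hσσ : σᴴ * σ = σ'ᴴ * σ')
    (horth : σ'ᴴ * σ = 0)
    (hinv1 : (σᴴ * σ) * ρ' = 1) (hinv2 : ρ' * (σᴴ * σ) = 1)
    (hc : ∀ (i j : Fin k) (a : Fin (2 * k + 2)) (b : Fin k),
      (ρ' i j * σ a b = σ a b * ρ' i j) ∧ (ρ' i j * σ' a b = σ' a b * ρ' i j) ∧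
      (ρ' i j * star (σ a b) = star (σ a b) * ρ' i j) ∧
      (ρ' i j * star (σ' a b) = star (σ' a b) * ρ' i j) ∧
      (ρ₁ i j * σ a b = σ a b * ρ₁ i j) ∧ (ρ₁ i j * σ' a b = σ' a b * ρ₁ i j) ∧
      (ρ₁ i j * star (σ a b) = star (σ a b) * ρ₁ i j) ∧
      (ρ₁ i j * star (σ' a b) = star (σ' a b) * ρ₁ i j))
    (Ψ : Fin k → Matrix (Fin (2 * k + 2)) (Fin 2) R)
    (hΨ : ∀ l, Ψ l = Matrix.of fun i j => ![(σ * ρ₁) i l, (σ' * ρ₁) i l] j) :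
    (∀ l, (Ψ l)ᴴ * Ψ l = 1) ∧
    (∑ l, Ψ l * (Ψ l)ᴴ) = σ * ρ' * σᴴ + σ' * ρ' * σ'ᴴ := by
  have norm_of (τ : Matrix (Fin (2 * k + 2)) (Fin k) R) (h : σᴴ * σ = τᴴ * τ) :
      (τ * ρ₁)ᴴ * (τ * ρ₁) = 1 := by
    rw [conjTranspose_mul, hρ₁, Matrix.mul_assoc, ← Matrix.mul_assoc τᴴ, ← h,
      ← Matrix.mul_assoc, hcommρ, Matrix.mul_assoc, hsq, hinv1]
  have orth_of (τ τ' : Matrix (Fin (2 * k + 2)) (Fin k) R) (h : τᴴ * τ' = 0) :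
      (τ * ρ₁)ᴴ * (τ' * ρ₁) = 0 := by
    rw [conjTranspose_mul, Matrix.mul_assoc, ← Matrix.mul_assoc τᴴ, h, Matrix.zero_mul,
      Matrix.mul_zero]
  have horth' : σᴴ * σ' = 0 := by simpa using congrArg conjTranspose horth
  have hσ_norm := norm_of σ rfl
  have hσ'_norm := norm_of σ' hσσ
  have hσσ'_orth := orth_of σ σ' horth'
  have hσ'σ_orth := orth_of σ' σ horth
  have outer (τ : Matrix (Fin (2 * k + 2)) (Fin k) R) :
      τ * ρ' * τᴴ = (τ * ρ₁) * (τ * ρ₁)ᴴ := by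
    simp only [conjTranspose_mul, hρ₁, ← hsq, Matrix.mul_assoc]
  rw [outer, outer]
  generalize σ * ρ₁ = A at *
  generalize σ' * ρ₁ = B at *
  refine ⟨fun l => ?_, ?_⟩
  · have hA := congrFun₂ hσ_norm l l
    have hB := congrFun₂ hσ'_norm l l
    have hAB := congrFun₂ hσσ'_orth l l
    have hBA := congrFun₂ hσ'σ_orth l l
    simp only [mul_apply, conjTranspose_apply, one_apply_eq, Matrix.zero_apply] at hA hB hAB hBA
    ext i j
    fin_cases i <;> fin_cases j <;> simp [hΨ, mul_apply, hA, hB, hAB, hBA]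
  · ext i j
    simp [hΨ, Matrix.sum_apply, mul_apply, Fin.sum_univ_two, Finset.sum_add_distrib]
end

section
/- Let A be a unital associative ℂ-algebra with a conjugate-linear involutive anti-automorphism a ↦ a*, and let z₁,z₂,z₃,z₄ ∈ A satisfy z_j z_l = η_{jl} z_l z_j and z_j z_l* = η_{lj} z_l* z_j for all j,l ∈ {1,…,4}. Suppose r² := z₁*z₁ + z₂*z₂ + z₃*z₃ + z₄*z₄ has an inverse r^{-2} with r² r^{-2} = r^{-2} r² = 1 and r^{-2} central. Let σ := (z₁,z₂,z₃,z₄)ᵗ and σ' := (−z₂*, z₁*, −z₄*, z₃*)ᵗ be 4×1 columns over A, and let τ := (−z₂, z₁, −z₄, z₃) be a 1×4 row. Then: (i) τσ = 0 and σ'^★σ = 0; (ii) σ^★σ = σ'^★σ' = r²; and (iii) with α := 2(z₁z₃* + z₂*z₄), β := 2(z₂z₃* − z₁*z₄), x := z₁z₁* + z₂z₂* − z₃z₃* − z₄z₄*, the 4×4 matrix σ r^{-2} σ^★ + σ' r^{-2} σ'^★ equals (1/2)·r^{-2} times the matrix [[r²+x, 0, α, −μ̄β*], [0, r²+x, β,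 μα*], [α*, β*, r²−x, 0], [−μβ, μ̄α, 0, r²−x]]; in particular it is a self-adjoint idempotent. -/
open Matrix

set_option maxHeartbeats 400000 in
/-- The tautological charge-one monad on deformed ℂ⁴_θ with the origin
removed: for σ = (z₁,z₂,z₃,z₄)ᵗ, σ' = (−z₂*,z₁*,−z₄*,z₃*)ᵗ and τ = (−z₂,z₁,−z₄,z₃),
one has (i) τσ = 0 and σ'^★σ = 0; (ii) σ^★σ = σ'^★σ' = r²; and (iii) the matrix
σ r^{-2} σ^★ + σ' r^{-2} σ'^★ equals (1/2)·r^{-2} times the basic-instanton matrix, and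
in particular it is a self-adjoint idempotent. -/
theorem stmt18 (θ : ℝ) (A : Type*) [Ring A] [Algebra ℂ A] [StarRing A] [StarModule ℂ A]
    (z : Fin 4 → A)
    (hzz : ∀ j l, z j * z l = etaDef θ j l • (z l * z j))
    (hzs : ∀ j l, z j * star (z l) = etaDef θ l j • (star (z l) * z j))
    (r2 rinv : A)
    (hr2 : r2 = star (z 0) * z 0 + star (z 1) * z 1 + star (z 2) * z 2 + star (z 3) * z 3)
    (hinv1 : r2 * rinv = 1) (hinv2 : rinv * r2 = 1)
    (hcentral : ∀ a : A, rinv * a = a * rinv)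
    (σ σ' : Matrix (Fin 4) (Fin 1) A) (τ : Matrix (Fin 1) (Fin 4) A)
    (hσ : σ = Matrix.of fun i _ => ![z 0, z 1, z 2, z 3] i)
    (hσ' : σ' = Matrix.of fun i _ => ![-star (z 1), star (z 0), -star (z 3), star (z 2)] i)
    (hτ : τ = Matrix.of fun _ j => ![-z 1, z 0, -z 3, z 2] j)
    (α β x : A)
    (hα : α = 2 * (z 0 * star (z 2) + star (z 1) * z 3))
    (hβ : β = 2 * (z 1 * star (z 2) - star (z 0) * z 3))
    (hx : x = z 0 * star (z 0) + z 1 * star (z 1) - z 2 * star (z 2) - z 3 * star (z 3))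
    (Q : Matrix (Fin 4) (Fin 4) A)
    (hQ : Q = Matrix.of fun a b =>
      σ a 0 * rinv * star (σ b 0) + σ' a 0 * rinv * star (σ' b 0)) :
    τ * σ = 0 ∧
    σ'ᴴ * σ = 0 ∧
    (σᴴ * σ) 0 0 = r2 ∧
    (σ'ᴴ * σ') 0 0 = r2 ∧
    Q = (1/2 : ℂ) • Matrix.of (fun a b => rinv *
      (!![r2 + x, 0, α, -(starRingEnd ℂ (muDef θ)) • star β;
          0, r2 + x, β, (muDef θ) • star α;
          star α, star β, r2 - x, 0;
          -((muDef θ) • β), (starRingEnd ℂ (muDef θ)) • α, 0, r2 - x] a b)) ∧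
    Qᴴ = Q ∧
    Q * Q = Q := by
  have hmu : (starRingEnd ℂ (muDef θ)) * muDef θ = 1 := conj_muDef_mul_muDef θ
  have hmu' : muDef θ * (starRingEnd ℂ (muDef θ)) = 1 := by rw [mul_comm, hmu]
  have n0 := hzs 0 0
  have n1 := hzs 1 1
  have n2 := hzs 2 2
  have n3 := hzs 3 3
  have c01 := hzz 0 1
  have c23 := hzz 2 3
  have s01 := hzs 0 1
  have s10 := hzs 1 0
  have s23 := hzs 2 3
  have s32 := hzs 3 2
  have s02 := hzs 0 2
  have s20 := hzs 2 0
  have s03 := hzs 0 3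
  have s30 := hzs 3 0
  have s12 := hzs 1 2
  have s21 := hzs 2 1
  have s13 := hzs 1 3
  have s31 := hzs 3 1
  simp only [etaDef, cons_val_zero, cons_val_one, cons_val, one_smul]
    at n0 n1 n2 n3 c01 c23 s01 s10 s23 s32 s02 s20 s03 s30 s12 s21 s13 s31
  have hr2star : star r2 = r2 := by
    rw [hr2]
    simp only [star_add, star_mul, star_star]
  have hrinvstar : star rinv = rinv :=
    left_inv_eq_right_inv (by rw [← hr2star, ← star_mul, hinv1, star_one]) hinv1
  have hτσ : τ * σ = 0 := by
    ext i j
    simp [hτ, hσ, Matrix.mul_apply, Fin.sum_univ_four, c01, c23]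
  have hσ'σ : σ'ᴴ * σ = 0 := by
    ext i j
    simp [hσ', hσ, Matrix.mul_apply, Fin.sum_univ_four, c01, c23]
  have hσσ' : σᴴ * σ' = 0 := by
    simpa using congrArg conjTranspose hσ'σ
  have hσσ : σᴴ * σ = r2 • (1 : Matrix (Fin 1) (Fin 1) A) := by
    ext i j
    fin_cases i; fin_cases j
    simp [hσ, hr2, Matrix.mul_apply, Fin.sum_univ_four]
  have hσ'σ' : σ'ᴴ * σ' = r2 • (1 : Matrix (Fin 1) (Fin 1) A) := by
    ext i j
    fin_cases i; fin_cases j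
    simp [hσ', hr2, Matrix.mul_apply, Fin.sum_univ_four, n0, n1, n2, n3]
    abel
  have hQmul : Q = σ * (rinv • σᴴ) + σ' * (rinv • σ'ᴴ) := by
    ext i j
    simp [hQ, Matrix.mul_apply, mul_assoc]
  have hQapply : ∀ a b, Q a b = rinv * (σ a 0 * star (σ b 0) + σ' a 0 * star (σ' b 0)) := by
    intro a b
    rw [hQ, Matrix.of_apply, ← hcentral (σ a 0), ← hcentral (σ' a 0), mul_add, mul_assoc, mul_assoc]
  refine ⟨hτσ, hσ'σ, by simp [hσσ], by simp [hσ'σ'], ?_, ?_, ?_⟩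
  · ext a b
    rw [hQapply, Matrix.smul_apply, Matrix.of_apply, ← mul_smul_comm]
    congr 1
    rw [one_div, eq_inv_smul_iff₀ (two_ne_zero' ℂ)]
    fin_cases a <;> fin_cases b <;>
      simp [hσ, hσ', hα, hβ, hx, hr2, n0, n1, n2, n3, s01, s10, s23, s32, s02, s20, s03, s30,
        s12, s21, s13, s31, two_smul, two_mul, smul_smul, smul_sub, hmu, hmu'] <;>
      module
  · ext a b
    rw [conjTranspose_apply, hQapply, hQapply, star_mul, hrinvstar, ← hcentral]
    simp only [star_add, star_mul, star_star]
  · have hcancel : ∀ M : Matrix (Fin 1) (Fin 4) A, rinv • r2 • M = M := fun M => by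
      rw [smul_smul, hinv2, one_smul]
    have hcross : ∀ (u v : Matrix (Fin 4) (Fin 1) A) (M : Matrix (Fin 1) (Fin 4) A),
        (rinv • uᴴ) * (v * M) = rinv • (uᴴ * v * M) := fun u v M => by
      rw [Matrix.smul_mul, Matrix.mul_assoc]
    simp only [hQmul, Matrix.add_mul, Matrix.mul_add, Matrix.mul_assoc σ, Matrix.mul_assoc σ',
      hcross, hσσ, hσσ', hσ'σ, hσ'σ', Matrix.smul_mul, Matrix.one_mul, Matrix.zero_mul, smul_zero,
      Matrix.mul_zero, hcancel, add_zero, zero_add]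
end
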